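/- Coordinate form of the degenerate metric on the region x·x > 0 (the ℝ × H³ structure): fix l > 0 and define Φ : (0,∞) × (0,∞) × (0,π) × (0,2π) → ℝ⁴ by Φ(η̃, r, θ, φ) = (l²/η̃) ( cosh(r/l), sinh(r/l) sin θ cos φ, sinh(r/l) sin θ sin φ, sinh(r/l) cos θ ). Then Φ(y)·Φ(y) = l⁴/η̃² > 0 for all y in the domain, and the pullback under Φ of the degenerate metric g⁻_{μν}(x) = −(l²/(x·x)²)(x_μ x_ν − (x·x) η_{μν}) is (Φ*g⁻)_{ab}(y) = g⁻_{μν}(Φ(y)) ∂_a Φ^μ(y) ∂_b Φ^ν(y) = diag(0, −1, −l² sinh²(r/l), −l² sinh²(r/l) sin²θ) in the coordinates (η̃, r, θ, φ); that is, Φ*g⁻ = −dr² − l² sinh²(r/l)(dθ² + sin²θ dφ²), the metric of a line bundle over hyperbolic 3-space of radius l. -/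

import Mathlib

noncomputable section

open scoped BigOperators

/-- The Minkowski metric η = diag(1,−1,−1,−1), as a function of two indices. -/
def etaF : Fin 4 → Fin 4 → ℝ := fun μ ν => if μ = ν then (if μ = 0 then 1 else -1) else 0

/-- The Minkowski product x·y = η_{μν} x^μ y^ν. -/
def mdot (x y : Fin 4 → ℝ) : ℝ := ∑ μ, ∑ ν, etaF μ ν * x μ * y ν

/-- The lowered index x_μ = η_{μν} x^ν. -/
def lowr (x : Fin 4 → ℝ) (μ : Fin 4) : ℝ := ∑ ν, etaF μ ν * x ν

/-- The partial derivative ∂_λ f (x). -/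
def pdv (f : (Fin 4 → ℝ) → ℝ) (lam : Fin 4) (x : Fin 4 → ℝ) : ℝ :=
  fderiv ℝ f x (Pi.single lam 1)

/-- A ∈ 𝔰𝔬(1,3), i.e. Aᵀη + ηA = 0, written componentwise. -/
def so13 (A : Fin 4 → Fin 4 → ℝ) : Prop :=
  ∀ μ ν, (∑ κ, A κ μ * etaF κ ν) + (∑ κ, etaF μ κ * A κ ν) = 0

/-- The 𝔭₂ vector field ξ(x) = A x + (b·x) x. -/
def xiP2 (A : Fin 4 → Fin 4 → ℝ) (b : Fin 4 → ℝ) (x : Fin 4 → ℝ) : Fin 4 → ℝ :=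
  fun μ => (∑ ν, A μ ν * x ν) + mdot b x * x μ

/-- Lie derivative of a covariant symmetric 2-tensor field g along a vector field ξ:
  (ℒ_ξ g)_{μν} = ξ^λ ∂_λ g_{μν} + g_{μλ} ∂_ν ξ^λ + g_{λν} ∂_μ ξ^λ. -/
def lieG (ξf : (Fin 4 → ℝ) → Fin 4 → ℝ) (g : (Fin 4 → ℝ) → Fin 4 → Fin 4 → ℝ)
    (x : Fin 4 → ℝ) (μ ν : Fin 4) : ℝ :=
  (∑ lam, ξf x lam * pdv (fun y => g y μ ν) lam x)
  + (∑ lam, g x μ lam * pdv (fun y => ξf y lam) ν x)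
  + (∑ lam, g x lam ν * pdv (fun y => ξf y lam) μ x)

/-- Lie derivative of a contravariant symmetric 2-tensor field h along a vector field ξ:
  (ℒ_ξ h)^{μν} = ξ^λ ∂_λ h^{μν} − h^{μλ} ∂_λ ξ^ν − h^{λν} ∂_λ ξ^μ. -/
def lieH (ξf : (Fin 4 → ℝ) → Fin 4 → ℝ) (h : (Fin 4 → ℝ) → Fin 4 → Fin 4 → ℝ)
    (x : Fin 4 → ℝ) (μ ν : Fin 4) : ℝ :=
  (∑ lam, ξf x lam * pdv (fun y => h y μ ν) lam x)
  - (∑ lam, h x μ lam * pdv (fun y => ξf y ν) lam x)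
  - (∑ lam, h x lam ν * pdv (fun y => ξf y μ) lam x)

/-- Lie derivative of a connection Γ^μ_{νρ} along a vector field ξ ([ℒ_ξ, ∇]):
  ξ^λ ∂_λ Γ^μ_{νρ} − Γ^λ_{νρ} ∂_λ ξ^μ + Γ^μ_{λρ} ∂_ν ξ^λ + Γ^μ_{νλ} ∂_ρ ξ^λ + ∂_ν ∂_ρ ξ^μ. -/
def lieConn (ξf : (Fin 4 → ℝ) → Fin 4 → ℝ)
    (Γ : (Fin 4 → ℝ) → Fin 4 → Fin 4 → Fin 4 → ℝ)
    (x : Fin 4 → ℝ) (μ ν ρ : Fin 4) : ℝ :=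
  (∑ lam, ξf x lam * pdv (fun y => Γ y μ ν ρ) lam x)
  - (∑ lam, Γ x lam ν ρ * pdv (fun y => ξf y μ) lam x)
  + (∑ lam, Γ x μ lam ρ * pdv (fun y => ξf y lam) ν x)
  + (∑ lam, Γ x μ ν lam * pdv (fun y => ξf y lam) ρ x)
  + pdv (fun y => pdv (fun z => ξf z μ) ρ y) ν x

/-- The canonical degenerate covariant metric g_{μν}(x) = (x_μ x_ν − (x·x) η_{μν})/(x·x)². -/
def gC (x : Fin 4 → ℝ) (μ ν : Fin 4) : ℝ :=
  (lowr x μ * lowr x ν - mdot x x * etaF μ ν) / (mdot x x) ^ 2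

/-- The canonical degenerate contravariant metric h^{μν}(x) = (x·x) x^μ x^ν. -/
def hC (x : Fin 4 → ℝ) (μ ν : Fin 4) : ℝ := mdot x x * x μ * x ν

/-- The canonical connection Γ^μ_{νλ}(x) = −(x_ν δ^μ_λ + δ^μ_ν x_λ)/(x·x). -/
def GammaC (x : Fin 4 → ℝ) (μ ν lam : Fin 4) : ℝ :=
  -(lowr x ν * (if μ = lam then 1 else 0) + (if μ = ν then 1 else 0) * lowr x lam) / mdot x x

open Real in
/-- The coordinate map Φ(η̃, r, θ, φ) on the region x·x > 0. -/
def PhiMap (l : ℝ) (y : Fin 4 → ℝ) : Fin 4 → ℝ :=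
  ![(l ^ 2 / y 0) * cosh (y 1 / l),
    (l ^ 2 / y 0) * sinh (y 1 / l) * sin (y 2) * cos (y 3),
    (l ^ 2 / y 0) * sinh (y 1 / l) * sin (y 2) * sin (y 3),
    (l ^ 2 / y 0) * sinh (y 1 / l) * cos (y 2)]

/-- The degenerate covariant metric g⁻_{μν}(x) = −(l²/(x·x)²)(x_μ x_ν − (x·x) η_{μν}). -/
def gMinus (l : ℝ) (x : Fin 4 → ℝ) (μ ν : Fin 4) : ℝ :=
  -(l ^ 2 / (mdot x x) ^ 2) * (lowr x μ * lowr x ν - mdot x x * etaF μ ν)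

open Real in
/-- The diagonal entries of the pulled-back metric: diag(0, −1, −l²sinh²(r/l),
−l²sinh²(r/l)sin²θ), i.e. Φ*g⁻ = −dr² − l²sinh²(r/l)(dθ² + sin²θ dφ²). -/
def pullDiag (l : ℝ) (y : Fin 4 → ℝ) : Fin 4 → ℝ :=
  ![0, -1, -(l ^ 2) * sinh (y 1 / l) ^ 2,
    -(l ^ 2) * sinh (y 1 / l) ^ 2 * sin (y 2) ^ 2]

lemma mdot_expand (x y : Fin 4 → ℝ) :
    mdot x y = x 0 * y 0 - x 1 * y 1 - x 2 * y 2 - x 3 * y 3 := by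
  simp [mdot, etaF, Fin.sum_univ_four]
  ring

lemma gMinus_contract (l : ℝ) (x v w : Fin 4 → ℝ) :
    ∑ μ, ∑ ν, gMinus l x μ ν * v μ * w ν
      = -(l ^ 2 / (mdot x x) ^ 2) * (mdot x v * mdot x w - mdot x x * mdot v w) := by
  generalize hM : mdot x x = M
  simp [gMinus, hM, mdot_expand x v, mdot_expand x w, mdot_expand v w, lowr, etaF,
    Fin.sum_univ_four]
  ring

/-- The differential of the coordinate map applied to a vector. -/
def dPhi (l : ℝ) (y v : Fin 4 → ℝ) : Fin 4 → ℝ :=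
  ![-(l ^ 2 / y 0 ^ 2) * v 0 * Real.cosh (y 1 / l)
      + (l ^ 2 / y 0) * (Real.sinh (y 1 / l) * (v 1 / l)),
    (-(l ^ 2 / y 0 ^ 2) * v 0 * Real.sinh (y 1 / l)
      + (l ^ 2 / y 0) * (Real.cosh (y 1 / l) * (v 1 / l))) * Real.sin (y 2) * Real.cos (y 3)
      + (l ^ 2 / y 0) * Real.sinh (y 1 / l)
        * (Real.cos (y 2) * v 2 * Real.cos (y 3) - Real.sin (y 2) * (Real.sin (y 3) * v 3)),
    (-(l ^ 2 / y 0 ^ 2) * v 0 * Real.sinh (y 1 / l)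
      + (l ^ 2 / y 0) * (Real.cosh (y 1 / l) * (v 1 / l))) * Real.sin (y 2) * Real.sin (y 3)
      + (l ^ 2 / y 0) * Real.sinh (y 1 / l)
        * (Real.cos (y 2) * v 2 * Real.sin (y 3) + Real.sin (y 2) * (Real.cos (y 3) * v 3)),
    (-(l ^ 2 / y 0 ^ 2) * v 0 * Real.sinh (y 1 / l)
      + (l ^ 2 / y 0) * (Real.cosh (y 1 / l) * (v 1 / l))) * Real.cos (y 2)
      - (l ^ 2 / y 0) * Real.sinh (y 1 / l) * (Real.sin (y 2) * v 2)]

lemma pdv_PhiMap (l : ℝ) (y : Fin 4 → ℝ) (h0 : y 0 ≠ 0) (a μ : Fin 4) :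
    pdv (fun z => PhiMap l z μ) a y = dPhi l y (Pi.single a 1) μ := by
  have hp : ∀ i : Fin 4, HasFDerivAt (fun z : Fin 4 → ℝ => z i)
      (ContinuousLinearMap.proj (R := ℝ) (φ := fun _ : Fin 4 => ℝ) i) y :=
    fun i => hasFDerivAt_apply i y
  have hA := ((hasDerivAt_inv h0).comp_hasFDerivAt y (hp 0)).const_mul (l ^ 2)
  have hr := (hp 1).mul_const l⁻¹
  have hC := hr.cosh
  have hS := hr.sinh
  have hs2 := (hp 2).sin
  have hc2 := (hp 2).cos
  have hs3 := (hp 3).sin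
  have hc3 := (hp 3).cos
  unfold pdv
  fin_cases μ
  · have h := (hA.mul hC).fderiv
    simp only [PhiMap, dPhi, div_eq_mul_inv] at h ⊢
    refine (congrArg (fun L => L (Pi.single a 1)) h).trans ?_
    simp
    ring
  · have h := (((hA.mul hS).mul hs2).mul hc3).fderiv
    simp only [PhiMap, dPhi, div_eq_mul_inv] at h ⊢
    refine (congrArg (fun L => L (Pi.single a 1)) h).trans ?_
    simp
    ring
  · have h := (((hA.mul hS).mul hs2).mul hs3).fderiv
    simp only [PhiMap, dPhi, div_eq_mul_inv] at h ⊢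
    refine (congrArg (fun L => L (Pi.single a 1)) h).trans ?_
    simp
    ring
  · have h := ((hA.mul hS).mul hc2).fderiv
    simp only [PhiMap, dPhi, div_eq_mul_inv] at h ⊢
    refine (congrArg (fun L => L (Pi.single a 1)) h).trans ?_
    simp
    ring

lemma mdot_PhiMap_self (l : ℝ) (y : Fin 4 → ℝ) :
    mdot (PhiMap l y) (PhiMap l y) = l ^ 4 / (y 0) ^ 2 := by
  have e1 := Real.cosh_sq (y 1 / l)
  have e2 := Real.cos_sq' (y 2)
  have e3 := Real.cos_sq' (y 3)
  rw [mdot_expand]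
  simp [PhiMap]
  ring_nf
  ring_nf at e1 e2 e3
  rw [e1, e2, e3]
  ring

lemma mdot_PhiMap_dPhi (l : ℝ) (y v : Fin 4 → ℝ) :
    mdot (PhiMap l y) (dPhi l y v) = -(l ^ 4 / (y 0) ^ 3) * v 0 := by
  have e1 := Real.cosh_sq (y 1 / l)
  have e2 := Real.cos_sq' (y 2)
  have e3 := Real.cos_sq' (y 3)
  rw [mdot_expand]
  simp [PhiMap, dPhi]
  ring_nf
  ring_nf at e1 e2 e3
  rw [e1, e2, e3]
  ring

lemma mdot_dPhi_dPhi (l : ℝ) (hl : l ≠ 0) (y v w : Fin 4 → ℝ) :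
    mdot (dPhi l y v) (dPhi l y w) = l ^ 4 / (y 0) ^ 4 * (v 0 * w 0)
      - l ^ 2 / (y 0) ^ 2 * (v 1 * w 1 + l ^ 2 * Real.sinh (y 1 / l) ^ 2
        * (v 2 * w 2 + Real.sin (y 2) ^ 2 * (v 3 * w 3))) := by
  have e1 := Real.cosh_sq (y 1 / l)
  have e2 := Real.cos_sq' (y 2)
  have e3 := Real.cos_sq' (y 3)
  rw [mdot_expand]
  simp [dPhi]
  generalize Real.cosh (y 1 / l) = C at *
  generalize Real.sinh (y 1 / l) = S at *
  generalize hv1 : v 1 / l = p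
  generalize hw1 : w 1 / l = q
  have hv : v 1 = p * l := by rw [← hv1]; field_simp
  have hw : w 1 = q * l := by rw [← hw1]; field_simp
  rw [hv, hw]
  ring_nf
  rw [e1, e2, e3]
  ring

/-- Coordinate form of the degenerate metric on the region x·x > 0 (the ℝ × H³
structure): Φ lands in {x·x > 0} with Φ·Φ = l⁴/η̃², and the pullback of g⁻ under Φ is
diag(0, −1, −l²sinh²(r/l), −l²sinh²(r/l)sin²θ). -/
theorem stmt_19 (l : ℝ) (hl : 0 < l) (y : Fin 4 → ℝ)
    (h0 : 0 < y 0) (h1 : 0 < y 1) (h2 : y 2 ∈ Set.Ioo 0 Real.pi)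
    (h3 : y 3 ∈ Set.Ioo 0 (2 * Real.pi)) :
    (mdot (PhiMap l y) (PhiMap l y) = l ^ 4 / (y 0) ^ 2 ∧
      0 < mdot (PhiMap l y) (PhiMap l y)) ∧
    (∀ a b : Fin 4,
      (∑ μ, ∑ ν, gMinus l (PhiMap l y) μ ν
          * pdv (fun z => PhiMap l z μ) a y * pdv (fun z => PhiMap l z ν) b y)
        = if a = b then pullDiag l y a else 0) := by
  have hM := mdot_PhiMap_self l y
  refine ⟨⟨hM, by rw [hM]; positivity⟩, fun a b => ?_⟩
  simp only [pdv_PhiMap l y h0.ne']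
  rw [gMinus_contract, hM, mdot_PhiMap_dPhi, mdot_PhiMap_dPhi, mdot_dPhi_dPhi l hl.ne']
  have key : ∀ v w : Fin 4 → ℝ, -(l ^ 2 / (l ^ 4 / y 0 ^ 2) ^ 2) *
      (-(l ^ 4 / y 0 ^ 3) * v 0 * (-(l ^ 4 / y 0 ^ 3) * w 0) -
        l ^ 4 / y 0 ^ 2 * (l ^ 4 / (y 0) ^ 4 * (v 0 * w 0)
      - l ^ 2 / (y 0) ^ 2 * (v 1 * w 1 + l ^ 2 * Real.sinh (y 1 / l) ^ 2
        * (v 2 * w 2 + Real.sin (y 2) ^ 2 * (v 3 * w 3)))))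
      = -(v 1 * w 1 + l ^ 2 * Real.sinh (y 1 / l) ^ 2
        * (v 2 * w 2 + Real.sin (y 2) ^ 2 * (v 3 * w 3))) := by
    intro v w
    generalize Real.sinh (y 1 / l) = S
    have := hl.ne'
    have := h0.ne'
    field_simp
    ring
  rw [key]
  fin_cases a <;> fin_cases b <;> simp [pullDiag] <;> ring
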